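/- Let C be a q-ary Singleton-optimal [n,k,d;r]-locally repairable code with r ≥ 1, r < k, d ≥ 3, and r² + 2r < n − d. Then C must have a recovery set of size r+1: there exists an index i ∈ {1,…,n} such that every recovery set at i has size at least r+1 (and hence, since C has locality r, some recovery set at i has size exactly r+1). -/

import Mathlib

open Finset

section Defs

variable {F : Type*} [Field F] [Fintype F] [DecidableEq F]

/-- The minimum (Hamming) distance of the linear code `C` is exactly `d`. -/
def MinDistIs {n : ℕ} (C : Submodule F (Fin n → F)) (d : ℕ) : Prop :=
  (∃ c ∈ C, c ≠ 0 ∧ hammingNorm c = d) ∧ ∀ c ∈ C, c ≠ 0 → d ≤ hammingNorm c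

/-- `R` is a recovery set at coordinate `i` for the code `C`: any two codewords that agree
on all coordinates of `R` other than `i` also agree at `i`. -/
def IsRecoverySet {n : ℕ} (C : Submodule F (Fin n → F)) (i : Fin n)
    (R : Finset (Fin n)) : Prop :=
  i ∈ R ∧ ∀ u ∈ C, ∀ v ∈ C, (∀ j ∈ R, j ≠ i → u j = v j) → u i = v i

/-- The code `C` has locality `r`: every coordinate has a recovery set of size at most `r+1`. -/
def HasLocality {n : ℕ} (C : Submodule F (Fin n → F)) (r : ℕ) : Prop :=
  ∀ i : Fin n, ∃ R : Finset (Fin n), R.card ≤ r + 1 ∧ IsRecoverySet C i R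

/-- The parameters attain the Singleton-type bound for LRCs: `d = n - k - ⌈k/r⌉ + 2`. -/
def SingletonOptimalParams (n k d r : ℕ) : Prop :=
  (d : ℤ) = (n : ℤ) - (k : ℤ) - ⌈(k : ℚ) / (r : ℚ)⌉ + 2

/-- `C` is a Singleton-optimal `[n,k,d;r]`-locally repairable code over `F`. -/
def IsOptLRC {n : ℕ} (C : Submodule F (Fin n → F)) (k d r : ℕ) : Prop :=
  Module.finrank F ↥C = k ∧ MinDistIs C d ∧ HasLocality C r ∧ SingletonOptimalParams n k d r

/-- `x` belongs to the dual code of `C` (w.r.t. the standard bilinear form). -/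
def InDual {n : ℕ} (C : Submodule F (Fin n → F)) (x : Fin n → F) : Prop :=
  ∀ c ∈ C, ∑ i, x i * c i = 0

/-- `P` is a partition of the coordinates `{1,…,n}` into supports of dual codewords of
Hamming weight at most `r+1` (disjoint recovery sets). -/
def IsRecoveryPartition {n : ℕ} (C : Submodule F (Fin n → F)) (r : ℕ)
    (P : Finset (Finset (Fin n))) : Prop :=
  (∀ S ∈ P, ∃ c : Fin n → F, InDual C c ∧ c ≠ 0 ∧ hammingNorm c ≤ r + 1 ∧
      (Finset.univ.filter fun i => c i ≠ 0) = S) ∧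
  (∀ S ∈ P, ∀ T ∈ P, S ≠ T → Disjoint S T) ∧
  (∀ i : Fin n, ∃ S ∈ P, i ∈ S)

/-- `C` has disjoint recovery sets. -/
def HasDisjointRecoverySets {n : ℕ} (C : Submodule F (Fin n → F)) (r : ℕ) : Prop :=
  ∃ P : Finset (Finset (Fin n)), IsRecoveryPartition C r P

/-- The Main MDS Conjecture over `F`: every nontrivial MDS code over `F`
(dimension `κ` with `2 ≤ κ ≤ m - 2`, minimum distance `δ = m - κ + 1`) has
length `m` at most `q + 2`, where `q = |F|`. -/
def MDSConjecture (F : Type*) [Field F] [Fintype F] [DecidableEq F] : Prop :=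
  ∀ (m κ δ : ℕ) (D : Submodule F (Fin m → F)),
    Module.finrank F ↥D = κ → MinDistIs D δ → δ + κ = m + 1 →
    2 ≤ κ → κ + 2 ≤ m → m ≤ Fintype.card F + 2

end Defs

/-- Codewords of `C` vanishing on `T`. -/
def vanOn {F : Type*} [Field F] {n : ℕ} (C : Submodule F (Fin n → F)) (T : Finset (Fin n)) :
    Submodule F (Fin n → F) where
  carrier := {c | c ∈ C ∧ ∀ i ∈ T, c i = 0}
  add_mem' := by
    rintro a b ⟨ha, ha'⟩ ⟨hb, hb'⟩
    exact ⟨C.add_mem ha hb, fun i hi => by simp [ha' i hi, hb' i hi]⟩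
  zero_mem' := ⟨C.zero_mem, fun i _ => rfl⟩
  smul_mem' := by
    rintro a b ⟨hb, hb'⟩
    exact ⟨C.smul_mem a hb, fun i hi => by simp [hb' i hi]⟩

lemma mem_vanOn {F : Type*} [Field F] {n : ℕ} {C : Submodule F (Fin n → F)}
    {T : Finset (Fin n)} {c : Fin n → F} : c ∈ vanOn C T ↔ c ∈ C ∧ ∀ i ∈ T, c i = 0 := Iff.rfl

lemma finrank_vanOn_insert {F : Type*} [Field F] {n : ℕ} (C : Submodule F (Fin n → F))
    (T : Finset (Fin n)) (i : Fin n) :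
    Module.finrank F (vanOn C T) ≤ Module.finrank F (vanOn C (insert i T)) + 1 := by
  let φ : (Fin n → F) →ₗ[F] F := LinearMap.proj i
  have h1 : vanOn C (insert i T) = vanOn C T ⊓ LinearMap.ker φ := by
    ext c
    simp only [mem_vanOn, Submodule.mem_inf, LinearMap.mem_ker, φ, LinearMap.proj_apply,
      Finset.mem_insert, forall_eq_or_imp]
    tauto
  rw [h1]
  have h2 := Submodule.finrank_sup_add_finrank_inf_eq (vanOn C T) (LinearMap.ker φ)
  have h3 := LinearMap.finrank_range_add_finrank_ker φ
  have h4 := Submodule.finrank_le (vanOn C T ⊔ LinearMap.ker φ)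
  have h5 := Submodule.finrank_le (LinearMap.range φ)
  have h6 : Module.finrank F F = 1 := Module.finrank_self F
  omega

lemma finrank_vanOn_union {F : Type*} [Field F] {n : ℕ} (C : Submodule F (Fin n → F))
    (T S : Finset (Fin n)) :
    Module.finrank F (vanOn C T) ≤ Module.finrank F (vanOn C (S ∪ T)) + (S \ T).card := by
  induction S using Finset.induction_on with
  | empty => rw [Finset.empty_union]; omega
  | insert a S ha ih =>
    rw [Finset.insert_union]
    by_cases haT : a ∈ T
    · rw [Finset.insert_eq_of_mem (Finset.mem_union_right _ haT),
        Finset.insert_sdiff_of_mem _ haT]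
      exact ih
    · rw [Finset.insert_sdiff_of_notMem _ haT, Finset.card_insert_of_notMem (by simp [ha])]
      have := finrank_vanOn_insert C (S ∪ T) a
      omega

lemma exists_undet {F : Type*} [Field F] {n : ℕ} (C : Submodule F (Fin n → F))
    (T : Finset (Fin n)) (h : 1 ≤ Module.finrank F (vanOn C T)) :
    ∃ c ∈ vanOn C T, ∃ i, c i ≠ 0 := by
  by_contra! hcon
  have : vanOn C T = ⊥ := by
    rw [Submodule.eq_bot_iff]
    intro c hc
    ext i
    exact hcon c hc i
  rw [this] at h
  simp at h

lemma dist_bound {F : Type*} [Field F] [Fintype F] [DecidableEq F] {n d : ℕ}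
    (C : Submodule F (Fin n → F)) (hd : ∀ c ∈ C, c ≠ 0 → d ≤ hammingNorm c) (j : ℕ) :
    ∀ T : Finset (Fin n), j + 1 ≤ Module.finrank F (vanOn C T) → d + T.card + j ≤ n := by
  induction j with
  | zero =>
    intro T hT
    obtain ⟨c, hc, i, hi⟩ := exists_undet C T hT
    have h1 := hd c hc.1 (fun h => hi (by rw [h]; rfl))
    have h2 : hammingNorm c ≤ (Tᶜ).card := by
      unfold hammingNorm
      apply Finset.card_le_card
      intro x hx
      simp only [Finset.mem_filter] at hx
      rw [Finset.mem_compl]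
      exact fun hxT => hx.2 (hc.2 x hxT)
    have h3 := Finset.card_add_card_compl T
    simp only [Fintype.card_fin] at h3
    omega
  | succ j ih =>
    intro T hT
    obtain ⟨c, hc, i, hi⟩ := exists_undet C T (by omega)
    have hiT : i ∉ T := fun h => hi (hc.2 i h)
    have h1 := finrank_vanOn_insert C T i
    have h2 := ih (insert i T) (by omega)
    rw [Finset.card_insert_of_notMem hiT] at h2
    omega

lemma build_set {F : Type*} [Field F] [Fintype F] [DecidableEq F] {n k s : ℕ}
    (C : Submodule F (Fin n → F)) (hk : Module.finrank F C = k)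
    (hloc : HasLocality C s) (m : ℕ) (hm : m * s < k + s) :
    ∃ T : Finset (Fin n), k + m ≤ T.card + Module.finrank F (vanOn C T) ∧
      k ≤ Module.finrank F (vanOn C T) + m * s := by
  induction m with
  | zero =>
    refine ⟨∅, ?_⟩
    have : vanOn C ∅ = C := by ext c; simp [mem_vanOn]
    rw [this]
    omega
  | succ m ih =>
    rw [Nat.succ_mul] at hm ⊢
    obtain ⟨T, h1, h2⟩ := ih (by omega)
    obtain ⟨c, hc, i, hi⟩ := exists_undet C T (by omega)
    have hiT : i ∉ T := fun h => hi (hc.2 i h)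
    obtain ⟨R, hR, hiR, hrec⟩ := hloc i
    have h3 := finrank_vanOn_union C T (R.erase i)
    have h4 : (R.erase i \ T).card ≤ s := by
      have := Finset.card_le_card (Finset.sdiff_subset (s := R.erase i) (t := T))
      rw [Finset.card_erase_of_mem hiR] at this
      omega
    have h5 : vanOn C (insert i (R.erase i ∪ T)) = vanOn C (R.erase i ∪ T) := by
      ext x
      simp only [mem_vanOn, Finset.mem_insert, forall_eq_or_imp]
      refine ⟨fun h => ⟨h.1, h.2.2⟩, fun h => ⟨h.1, ?_, h.2⟩⟩
      refine hrec x h.1 0 C.zero_mem (fun j hj hji => ?_)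
      exact h.2 j (Finset.mem_union_left _ (Finset.mem_erase.2 ⟨hji, hj⟩))
    refine ⟨insert i (R.erase i ∪ T), ?_⟩
    rw [h5, Finset.card_insert_of_notMem (by simp [hiT]), ← Finset.card_sdiff_add_card]
    omega

/-- Lemma 4.1: a Singleton-optimal `[n,k,d;r]`-LRC with `r ≥ 1`,
`r < k`, `d ≥ 3` and `r² + 2r < n - d` must have a recovery set of size exactly `r+1`:
there is a coordinate `i` at which every recovery set has size at least `r+1`, and hence
(by locality `r`) some recovery set at `i` has size exactly `r+1`. -/
theorem optLRC_has_full_recovery_set {F : Type*} [Field F] [Fintype F] [DecidableEq F]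
    {n k d r : ℕ} (C : Submodule F (Fin n → F))
    (hC : IsOptLRC C k d r) (hr : 1 ≤ r) (hrk : r < k) (hd : 3 ≤ d)
    (hn : (r : ℤ) ^ 2 + 2 * (r : ℤ) < (n : ℤ) - (d : ℤ)) :
    ∃ i : Fin n,
      (∀ R : Finset (Fin n), IsRecoverySet C i R → r + 1 ≤ R.card) ∧
      (∃ R : Finset (Fin n), IsRecoverySet C i R ∧ R.card = r + 1) := by
  obtain ⟨hk, ⟨-, hdist⟩, hloc, hopt⟩ := hC
  by_contra hcon
  push Not at hcon
  have hloc' : HasLocality C (r - 1) := by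
    intro i
    by_contra! hno
    have hall : ∀ R : Finset (Fin n), IsRecoverySet C i R → r + 1 ≤ R.card := by
      intro R hR
      by_contra hlt
      exact hno R (by omega) hR
    obtain ⟨R, hR, hrec⟩ := hloc i
    exact hcon i hall R hrec (le_antisymm hR (hall R hrec))
  unfold SingletonOptimalParams at hopt
  have hrq : (0 : ℚ) < r := by exact_mod_cast hr
  have c1 := Int.le_ceil ((k : ℚ) / r)
  have c2 := Int.ceil_lt_add_one ((k : ℚ) / r)
  have c0 : 0 ≤ ⌈(k : ℚ) / r⌉ := Int.ceil_nonneg (by positivity)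
  generalize ⌈(k : ℚ) / r⌉ = c at *
  obtain ⟨m, rfl⟩ := Int.eq_ofNat_of_zero_le c0
  obtain ⟨s, rfl⟩ : ∃ s, r = s + 1 := ⟨r - 1, by omega⟩
  rw [div_le_iff₀ hrq] at c1
  have c2' : (m : ℚ) * (s + 1 : ℕ) < k + (s + 1 : ℕ) := by
    have := mul_lt_mul_of_pos_right c2 hrq
    rw [add_mul, div_mul_cancel₀ _ hrq.ne'] at this
    push_cast at this ⊢
    linarith
  have d1 : k ≤ m * (s + 1) := by exact_mod_cast c1
  have d2 : m * (s + 1) < k + (s + 1) := by exact_mod_cast c2'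
  have d3 : s + 2 ≤ m := by
    by_contra hlt
    have : m ≤ s + 1 := by omega
    have := Nat.mul_le_mul_right (s + 1) this
    push_cast at hn
    zify at *
    nlinarith
  rw [Nat.add_sub_cancel] at hloc'
  have d4 : m * s < k := by rw [Nat.mul_succ] at d2; omega
  obtain ⟨T, h1, h2⟩ := build_set C hk hloc' m (by omega)
  have h3 := dist_bound C hdist (Module.finrank F (vanOn C T) - 1) T (by omega)
  omega
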